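/- Let p be a prime, q a power of p, and n = p^α · n_0 ≥ 5 with p not dividing n_0 and gcd(q − 1, n_0) = 1. Suppose x^n − 1 has a monic factor f of degree 2 in F_q[x]. If q^{n/2 − 2} ≥ 2^{(n+1)/2} · W(q^n − 1), then N_f(x^n − 1, q^n − 1) > 0. -/

import Mathlib

open Polynomial

noncomputable section

/-- The linearized `q`-associate of `f = Σ a_i x^i ∈ F_q[x]`, evaluated at `α ∈ F_{q^n}`:
`L_f(α) = Σ a_i α^{q^i}`. -/
def Lf {F E : Type*} [Field F] [Field E] [Algebra F E] (q : ℕ) (f : Polynomial F) (α : E) : E :=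
  ∑ i ∈ Finset.range (f.natDegree + 1), algebraMap F E (f.coeff i) * α ^ q ^ i

/-- For `m ∣ q^n - 1`, an element `α ∈ F_{q^n}*` is `m`-free if whenever `α = β^d` for some
`β ∈ F_{q^n}` and some divisor `d` of `m`, then `d = 1`. -/
def IsFree {E : Type*} [Field E] (m : ℕ) (α : E) : Prop :=
  α ≠ 0 ∧ ∀ d : ℕ, d ∣ m → (∃ β : E, α = β ^ d) → d = 1

/-- For a monic divisor `T` of `x^n - 1` in `F_q[x]`, an element `α ∈ F_{q^n}` is `T`-free
if whenever `α = L_h(β)` for some `β ∈ F_{q^n}` and some monic divisor `h` of `T`,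
then `h = 1`. -/
def IsPolyFree {F E : Type*} [Field F] [Field E] [Algebra F E] (q : ℕ) (T : Polynomial F)
    (α : E) : Prop :=
  ∀ h : Polynomial F, h.Monic → h ∣ T → (∃ β : E, Lf q h β = α) → h = 1

/-- `Nf q F E f T m` is the number of `T`-free elements `α ∈ F_{q^n}` such that `L_f(α)` is
`m`-free. -/
def Nf (q : ℕ) (F E : Type*) [Field F] [Field E] [Algebra F E]
    (f T : Polynomial F) (m : ℕ) : ℕ :=
  Nat.card {α : E // IsPolyFree q T α ∧ IsFree m (Lf q f α)}

/-- `Wnat m` is the number of squarefree divisors of the integer `m`. -/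
def Wnat (m : ℕ) : ℕ := Nat.card {d : ℕ // d ∣ m ∧ Squarefree d}

/-- `Wpoly T` is the number of squarefree monic divisors of the polynomial `T`. -/
def Wpoly {F : Type*} [Field F] (T : Polynomial F) : ℕ :=
  Nat.card {h : Polynomial F // h.Monic ∧ Squarefree h ∧ h ∣ T}

/-- `radNat m` is the largest squarefree divisor of the positive integer `m`. -/
def radNat (m : ℕ) : ℕ := ∏ p ∈ m.primeFactors, p

/-- `radPoly T` is the monic squarefree radical of the polynomial `T` : the product of its
distinct monic irreducible factors. -/
def radPoly {F : Type*} [Field F] (T : Polynomial F) : Polynomial F :=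
  letI := Classical.decEq F
  ∏ p ∈ (UniqueFactorizationMonoid.normalizedFactors T).toFinset, p

theorem MulChar.apply_zero_of_field {E : Type*} [Field E] (χ : MulChar E ℂ) : χ 0 = 0 :=
  χ.map_nonunit not_isUnit_zero

theorem MulChar.prod_apply_of_ne_zero {E ι : Type*} [Field E] (s : Finset ι)
    (χ : ι → MulChar E ℂ) {a : E} (ha : a ≠ 0) : (∏ i ∈ s, χ i) a = ∏ i ∈ s, χ i a := by
  classical
  induction s using Finset.induction_on with
  | empty => simp [MulChar.one_apply (isUnit_iff_ne_zero.mpr ha)]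
  | insert i s hi ih => rw [Finset.prod_insert hi, Finset.prod_insert hi, MulChar.mul_apply, ih]

section CharacterSums

variable {E : Type*} [Field E] [Fintype E]

theorem MulChar.norm_apply_le_one (χ : MulChar E ℂ) (a : E) : ‖χ a‖ ≤ 1 := by
  rcases eq_or_ne a 0 with rfl | ha
  · simp
  · refine (Complex.norm_eq_one_of_pow_eq_one (n := Fintype.card E - 1) ?_ ?_).le
    · rw [← map_pow, FiniteField.pow_card_sub_one_eq_one a ha, map_one]
    · have := Fintype.one_lt_card (α := E)
      omega

theorem norm_gaussSum_eq_sqrt_card {χ : MulChar E ℂ} (hχ : χ ≠ 1) {ψ : AddChar E ℂ}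
    (hψ : ψ.IsPrimitive) : ‖gaussSum χ ψ‖ = √(Fintype.card E) := by
  have h := gaussSum_mul_gaussSum_eq_card hχ hψ
  rw [← star_gaussSum_eq] at h
  have h' := congrArg norm h
  rw [norm_mul, norm_star, Complex.norm_natCast] at h'
  rw [← h', Real.sqrt_mul_self (norm_nonneg _)]

theorem gaussSum_inv_mulShift {χ : MulChar E ℂ} (hχ : χ ≠ 1) (ψ : AddChar E ℂ) (a : E) :
    gaussSum χ⁻¹ (ψ.mulShift a) = χ a * gaussSum χ⁻¹ ψ := by
  rcases eq_or_ne a 0 with rfl | ha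
  · rw [AddChar.mulShift_zero, gaussSum_one_right (inv_ne_one.mpr hχ),
      χ.apply_zero_of_field, zero_mul]
  · simpa using! gaussSum_mulShift_eq χ⁻¹ ψ (Units.mk0 a ha)

/-- Expanding `χ` as a combination of additive characters by means of a Gauss sum bounds the mixed
character sum attached to an additive endomorphism. -/
theorem norm_sum_mulChar_comp_mul_addChar_le [DecidableEq E] (L : E →+ E) {χ : MulChar E ℂ}
    (hχ : χ ≠ 1) (ψ : AddChar E ℂ) :
    ‖∑ a, χ (L a) * ψ a‖ ≤ √(Fintype.card E) * (Finset.univ.filter fun a => L a = 0).card := by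
  classical
  let e := AddChar.FiniteField.primitiveChar_to_Complex E
  have he : e.IsPrimitive := AddChar.FiniteField.primitiveChar_to_Complex_isPrimitive E
  let T : E → ℂ := fun c => ∑ a, e (c * L a) * ψ a
  have hTite (c : E) : T c = if (e.mulShift c).compAddMonoidHom L * ψ = 0
      then (Fintype.card E : ℂ) else 0 := by
    rw [← AddChar.sum_eq_ite]
    simp [T, AddChar.mul_apply, AddChar.mulShift_apply]
  have hTnorm (c : E) : ((‖T c‖ : ℝ) : ℂ) = T c := by
    rw [hTite]
    split_ifs <;> simp
  have hTsum : ∑ c, T c = Fintype.card E * ∑ a with L a = 0, ψ a := by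
    simp only [T]
    rw [Finset.sum_comm, Finset.sum_filter, Finset.mul_sum]
    refine Finset.sum_congr rfl fun a _ => ?_
    rw [← Finset.sum_mul, AddChar.sum_mulShift _ he]
    split_ifs <;> simp
  have hexp : (∑ a, χ (L a) * ψ a) * gaussSum χ⁻¹ e = ∑ c, χ⁻¹ c * T c := by
    simp only [T, Finset.mul_sum, Finset.sum_mul]
    rw [Finset.sum_comm]
    refine Finset.sum_congr rfl fun a _ => ?_
    rw [mul_right_comm, ← gaussSum_inv_mulShift hχ, gaussSum, Finset.sum_mul]
    refine Finset.sum_congr rfl fun c _ => ?_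
    rw [AddChar.mulShift_apply, mul_comm (L a), mul_assoc]
  have hker : ‖∑ a with L a = 0, ψ a‖ ≤ (Finset.univ.filter fun a => L a = 0).card := by
    refine (norm_sum_le _ _).trans (le_of_eq ?_)
    simp [AddChar.norm_apply]
  have hbound : ‖∑ a, χ (L a) * ψ a‖ * √(Fintype.card E) ≤
      Fintype.card E * (Finset.univ.filter fun a => L a = 0).card := by
    calc _ = ‖∑ c, χ⁻¹ c * T c‖ := by
          rw [← hexp, norm_mul, norm_gaussSum_eq_sqrt_card (inv_ne_one.mpr hχ) he]
      _ ≤ ∑ c, ‖T c‖ := by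
          refine (norm_sum_le _ _).trans (Finset.sum_le_sum fun c _ => ?_)
          rw [norm_mul]
          exact mul_le_of_le_one_left (norm_nonneg _) (χ⁻¹.norm_apply_le_one c)
      _ = ‖∑ c, T c‖ := by
          have h : ((∑ c, ‖T c‖ : ℝ) : ℂ) = ∑ c, T c := by
            push_cast
            exact Finset.sum_congr rfl fun c _ => hTnorm c
          rw [← h, Complex.norm_real, Real.norm_of_nonneg (by positivity)]
      _ ≤ _ := by
          rw [hTsum, norm_mul, Complex.norm_natCast]
          gcongr
  have hQ : (0 : ℝ) < √(Fintype.card E) := by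
    have := Fintype.card_pos (α := E)
    positivity
  refine le_of_mul_le_mul_right (hbound.trans (le_of_eq ?_)) hQ
  rw [mul_right_comm, Real.mul_self_sqrt (by positivity)]

theorem sum_one_mulChar_comp_mul_addChar [DecidableEq E] (L : E →+ E) (ψ : AddChar E ℂ) :
    ∑ a, (1 : MulChar E ℂ) (L a) * ψ a = ∑ a, ψ a - ∑ a with L a = 0, ψ a := by
  rw [Finset.sum_filter, ← Finset.sum_sub_distrib]
  refine Finset.sum_congr rfl fun a _ => ?_
  by_cases h : L a = 0
  · simp [h, MulChar.apply_zero_of_field]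
  · simp [h, MulChar.one_apply (isUnit_iff_ne_zero.mpr h)]

/-- If the kernel of `L` is small enough, finitely many independent multiplicative and additive
characters are simultaneously nontrivial at `L a` and `a` for a suitable `a`. -/
theorem exists_forall_char_ne_one {ι κ : Type*} (L : E →+ E) (s : Finset ι)
    (χ : ι → MulChar E ℂ) (hχ : ∀ S ⊆ s, S.Nonempty → ∏ i ∈ S, χ i ≠ 1) (t : Finset κ)
    (ψ : κ → AddChar E ℂ) (hψ : ∀ S ⊆ t, S.Nonempty → ∏ j ∈ S, ψ j ≠ 1)
    (hcard : (2 : ℝ) ^ s.card * 2 ^ t.card * Nat.card L.ker ≤ √(Fintype.card E)) :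
    ∃ a, L a ≠ 0 ∧ (∀ i ∈ s, χ i (L a) ≠ 1) ∧ ∀ j ∈ t, ψ j a ≠ 1 := by
  classical
  by_contra! hcon
  set K : ℕ := (Finset.univ.filter fun a => L a = 0).card with hK
  have hKker : Nat.card L.ker = K := by
    rw [hK, ← Fintype.card_subtype, ← Nat.card_eq_fintype_card]
    rfl
  rw [hKker] at hcard
  set Q : ℝ := (Fintype.card E : ℝ) with hQ
  have hQ1 : 1 < √Q := by
    rw [Real.lt_sqrt zero_le_one, one_pow, hQ]
    exact_mod_cast Fintype.one_lt_card (α := E)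
  have hQsq : √Q * √Q = Q := Real.mul_self_sqrt (by positivity)
  have hKpos : (0 : ℝ) < K := by
    rw [hK]
    exact_mod_cast Finset.card_pos.mpr ⟨0, by simp⟩
  have hker (φ : AddChar E ℂ) : ‖∑ a with L a = 0, φ a‖ ≤ K := by
    refine (norm_sum_le _ _).trans (le_of_eq ?_)
    simp [AddChar.norm_apply, hK]
  let A : Finset ι × Finset κ → ℂ := fun P =>
    ∑ a, (∏ i ∈ P.1, χ i : MulChar E ℂ) (L a) * (∏ j ∈ P.2, ψ j : AddChar E ℂ) a
  let I := s.powerset ×ˢ t.powerset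
  have hA0 : A (∅, ∅) = Q - K := by
    simp only [A, Finset.prod_empty, sum_one_mulChar_comp_mul_addChar]
    simp [hQ, hK]
  have hA (P) (hP : P ∈ I.erase (∅, ∅)) : ‖A P‖ ≤ √Q * K := by
    obtain ⟨S, S'⟩ := P
    simp only [I, Finset.mem_erase, Finset.mem_product, Finset.mem_powerset, ne_eq,
      Prod.mk.injEq] at hP
    obtain ⟨hne, hS, hS'⟩ := hP
    rcases S.eq_empty_or_nonempty with rfl | hSne
    · have hS'ne : S'.Nonempty := Finset.nonempty_iff_ne_empty.mpr fun h => hne ⟨rfl, h⟩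
      simp only [A, Finset.prod_empty]
      rw [sum_one_mulChar_comp_mul_addChar, AddChar.sum_eq_zero_of_ne_one (hψ S' hS' hS'ne),
        zero_sub, norm_neg]
      exact (hker _).trans (le_mul_of_one_le_left hKpos.le hQ1.le)
    · exact norm_sum_mulChar_comp_mul_addChar_le L (hχ S hS hSne) _
  have hsum : ∑ P ∈ I, (-1) ^ P.1.card * (-1) ^ P.2.card * A P = 0 := by
    have hexp (a : E) : ∑ P ∈ I, (-1) ^ P.1.card * (-1) ^ P.2.card *
        ((∏ i ∈ P.1, χ i : MulChar E ℂ) (L a) * (∏ j ∈ P.2, ψ j : AddChar E ℂ) a) = 0 := by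
      by_cases hLa : L a = 0
      · simp [hLa, MulChar.apply_zero_of_field]
      calc _ = ∑ P ∈ I, (∏ i ∈ P.1, -χ i (L a)) * ∏ j ∈ P.2, -ψ j a := by
            refine Finset.sum_congr rfl fun P _ => ?_
            rw [MulChar.prod_apply_of_ne_zero _ _ hLa, AddChar.prod_apply, Finset.prod_neg,
              Finset.prod_neg]
            ring
        _ = (∏ i ∈ s, (1 + -χ i (L a))) * ∏ j ∈ t, (1 + -ψ j a) := by
            rw [Finset.prod_one_add, Finset.prod_one_add, Finset.sum_mul_sum,
              ← Finset.sum_product']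
        _ = 0 := by
            by_cases h : ∃ i ∈ s, χ i (L a) = 1
            · obtain ⟨i, hi, h⟩ := h
              rw [Finset.prod_eq_zero hi (by simp [h]), zero_mul]
            · push Not at h
              obtain ⟨j, hj, h⟩ := hcon a hLa h
              rw [Finset.prod_eq_zero (s := t) hj (by simp [h]), mul_zero]
    simp only [A, Finset.mul_sum]
    rw [Finset.sum_comm]
    exact Finset.sum_eq_zero fun a _ => hexp a
  have hmem : ((∅, ∅) : Finset ι × Finset κ) ∈ I := by simp [I]
  rw [← Finset.add_sum_erase _ _ hmem, hA0] at hsum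
  have hle : Q - K ≤ (I.erase (∅, ∅)).card * (√Q * K) := by
    calc Q - K ≤ ‖(Q - K : ℂ)‖ := by
          exact_mod_cast le_abs_self (Q - K)
      _ = ‖∑ P ∈ I.erase (∅, ∅), (-1) ^ P.1.card * (-1) ^ P.2.card * A P‖ := by
          rw [← norm_neg]
          congr 1
          simpa using (eq_neg_of_add_eq_zero_right hsum).symm
      _ ≤ ∑ P ∈ I.erase (∅, ∅), √Q * K := by
          refine (norm_sum_le _ _).trans (Finset.sum_le_sum fun P hP => ?_)
          simpa using hA P hP
      _ = _ := by rw [Finset.sum_const, nsmul_eq_mul]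
  have hI : ((I.erase (∅, ∅)).card : ℝ) = 2 ^ s.card * 2 ^ t.card - 1 := by
    rw [Finset.card_erase_of_mem hmem, Nat.cast_pred (Finset.card_pos.mpr ⟨_, hmem⟩)]
    simp [I]
  rw [hI] at hle
  nlinarith [mul_le_mul_of_nonneg_right hcard (Real.sqrt_nonneg Q),
    mul_lt_mul_of_pos_right hQ1 hKpos]

end CharacterSums

section Groups

theorem prod_ne_one_of_orderOf_prime {G : Type*} [CommGroup G] {S : Finset ℕ}
    (hS : ∀ l ∈ S, l.Prime) {g : ℕ → G} (hg : ∀ l ∈ S, orderOf (g l) = l) (hne : S.Nonempty) :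
    ∏ l ∈ S, g l ≠ 1 := by
  classical
  intro h
  obtain ⟨l, hl⟩ := hne
  set k := ∏ j ∈ S.erase l, j
  have hpow : (∏ j ∈ S, g j) ^ k = g l ^ k := by
    rw [← Finset.mul_prod_erase S g hl, mul_pow, ← Finset.prod_pow,
      Finset.prod_eq_one fun j hj => ?_, mul_one]
    rw [← orderOf_dvd_iff_pow_eq_one, hg j (Finset.mem_of_mem_erase hj)]
    exact Finset.dvd_prod_of_mem _ hj
  rw [h, one_pow] at hpow
  have hdvd : l ∣ k := by
    have := orderOf_dvd_of_pow_eq_one hpow.symm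
    rwa [hg l hl] at this
  obtain ⟨j, hj, hlj⟩ := (hS l hl).prime.exists_mem_finset_dvd hdvd
  have hj' := Finset.mem_erase.mp hj
  exact hj'.1 ((Nat.prime_dvd_prime_iff_eq (hS l hl) (hS j hj'.2)).mp hlj).symm

theorem AddSubgroup.exists_addChar_ne_one {A : Type*} [AddCommGroup A] [Finite A]
    {H : AddSubgroup A} (hH : H ≠ ⊤) :
    ∃ ψ : AddChar A ℂ, ψ ≠ 1 ∧ ∀ x ∈ H, ψ x = 1 := by
  obtain ⟨x, hx⟩ : ∃ x, x ∉ H := by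
    by_contra! h
    exact hH (eq_top_iff.mpr fun x _ => h x)
  have hx0 : (QuotientAddGroup.mk x : A ⧸ H) ≠ 0 := by
    rwa [ne_eq, QuotientAddGroup.eq_zero_iff]
  obtain ⟨ψ, hψ⟩ := AddChar.exists_apply_ne_zero.mpr hx0
  refine ⟨ψ.compAddMonoidHom (QuotientAddGroup.mk' H), fun h => hψ ?_, fun y hy => ?_⟩
  · simpa using! DFunLike.congr_fun h x
  · have : (QuotientAddGroup.mk' H) y = 0 := (QuotientAddGroup.eq_zero_iff y).mpr hy
    rw [AddChar.compAddMonoidHom_apply, this, AddChar.map_zero_eq_one]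

theorem two_pow_card_primeFactors_le_Wnat {m : ℕ} (hm : m ≠ 0) :
    2 ^ m.primeFactors.card ≤ Wnat m := by
  classical
  have h := Nat.sum_divisors_filter_squarefree hm (f := fun _ => (1 : ℕ))
  rw [Nat.factors_eq, ← Finset.card_eq_sum_ones, ← Finset.card_eq_sum_ones,
    Finset.card_powerset] at h
  have hset : Wnat m = (m.divisors.filter Squarefree).card := by
    rw [Wnat, ← Nat.card_eq_finsetCard]
    refine Nat.card_congr (Equiv.subtypeEquivRight fun d => ?_)
    simp [hm]
  exact (hset.trans h).ge

end Groups

section Frobenius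

variable (F E : Type*) [Field F] [Fintype F] [Field E] [Algebra F E]

/-- The `q`-Frobenius of `E`, as an `F`-linear endomorphism. -/
def frobLin : Module.End F E := (FiniteField.frobeniusAlgHom F E).toLinearMap

theorem frobLin_pow_apply (i : ℕ) (a : E) : (frobLin F E ^ i) a = a ^ Fintype.card F ^ i := by
  induction i with
  | zero => simp
  | succ i ih =>
    rw [pow_succ', Module.End.mul_apply, ih, pow_succ, pow_mul]
    rfl

variable {F E}

theorem Lf_eq_aeval_frobLin (f : F[X]) (a : E) :
    Lf (Fintype.card F) f a = aeval (frobLin F E) f a := by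
  rw [Lf, aeval_eq_sum_range, LinearMap.sum_apply]
  refine Finset.sum_congr rfl fun i _ => ?_
  rw [LinearMap.smul_apply, frobLin_pow_apply, Algebra.smul_def]

theorem card_ker_aeval_frobLin_le {f : F[X]} (hf : f ≠ 0) :
    Nat.card (aeval (frobLin F E) f).toAddMonoidHom.ker ≤ Fintype.card F ^ f.natDegree := by
  classical
  set q := Fintype.card F
  have hq : 1 < q := Fintype.one_lt_card
  let P : E[X] := ∑ i ∈ Finset.range (f.natDegree + 1), C (algebraMap F E (f.coeff i)) * X ^ q ^ i
  have hcoeff : P.coeff (q ^ f.natDegree) = algebraMap F E f.leadingCoeff := by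
    simp only [P, finsetSum_coeff, coeff_C_mul, coeff_X_pow]
    rw [Finset.sum_eq_single f.natDegree]
    · simp
    · intro i _ hi
      rw [if_neg fun h => hi (Nat.pow_right_injective hq h).symm, mul_zero]
    · simp
  have hP : P ≠ 0 := by
    intro h
    rw [h, coeff_zero, eq_comm, map_eq_zero, leadingCoeff_eq_zero] at hcoeff
    exact hf hcoeff
  have hdeg : P.natDegree ≤ q ^ f.natDegree := by
    refine natDegree_sum_le_of_forall_le _ _ fun i hi => ?_
    refine (natDegree_C_mul_X_pow_le _ _).trans (Nat.pow_le_pow_right hq.le ?_)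
    exact Nat.lt_succ_iff.mp (Finset.mem_range.mp hi)
  have hsub : ((aeval (frobLin F E) f).toAddMonoidHom.ker : Set E) ⊆ P.roots.toFinset := by
    intro a ha
    have ha : aeval (frobLin F E) f a = 0 := ha
    rw [← Lf_eq_aeval_frobLin, Lf] at ha
    simpa [hP, P, eval_finsetSum] using! ha
  calc Nat.card (aeval (frobLin F E) f).toAddMonoidHom.ker
      = ((aeval (frobLin F E) f).toAddMonoidHom.ker : Set E).ncard := rfl
    _ ≤ P.roots.toFinset.card := by
        rw [← Set.ncard_coe_finset]
        exact Set.ncard_le_ncard hsub (Finset.finite_toSet _)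
    _ ≤ P.roots.card := Multiset.toFinset_card_le _
    _ ≤ _ := (card_roots' P).trans hdeg

theorem aeval_frobLin_not_surjective [Finite E] {h : F[X]} (hh : Irreducible h)
    (hdvd : h ∣ X ^ Module.finrank F E - 1) :
    ¬ Function.Surjective (aeval (frobLin F E) h) := by
  intro hs
  obtain ⟨k, hk⟩ := hdvd
  have hmin : minpoly F (frobLin F E) = X ^ Module.finrank F E - 1 :=
    FiniteField.minpoly_frobeniusAlgHom F E
  have hn : 0 < Module.finrank F E := Module.finrank_pos
  have hne : (X ^ Module.finrank F E - 1 : F[X]) ≠ 0 := (monic_X_pow_sub_C (1 : F) hn.ne').ne_zero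
  have hk0 : k ≠ 0 := by
    rintro rfl
    exact hne (by rw [hk, mul_zero])
  have hzero : aeval (frobLin F E) k = 0 := by
    have h0 := minpoly.aeval F (frobLin F E)
    rw [hmin, hk, mul_comm, map_mul] at h0
    ext x
    obtain ⟨y, rfl⟩ := hs x
    exact LinearMap.congr_fun h0 y
  have hle := natDegree_le_of_dvd (minpoly.dvd F (frobLin F E) hzero) hk0
  rw [hmin, hk, natDegree_mul hh.ne_zero hk0] at hle
  have := hh.natDegree_pos
  omega

/-- Characters vanishing on the images of pairwise coprime polynomials in an endomorphism are
independent. -/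
theorem prod_addChar_ne_one_of_coprime {K V : Type*} [Field K] [AddCommGroup V] [Module K V]
    (φ : Module.End K V) {S : Finset K[X]} (hcop : (S : Set K[X]).Pairwise IsCoprime)
    {ψ : K[X] → AddChar V ℂ} (hψ1 : ∀ h ∈ S, ψ h ≠ 1)
    (hψ : ∀ h ∈ S, ∀ x, ψ h (aeval φ h x) = 1) (hne : S.Nonempty) : ∏ h ∈ S, ψ h ≠ 1 := by
  classical
  intro hprod
  obtain ⟨h, hh⟩ := hne
  refine hψ1 h hh (DFunLike.ext _ _ fun x => ?_)
  have hcop' : IsCoprime h (∏ j ∈ S.erase h, j) := by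
    refine IsCoprime.prod_right fun j hj => ?_
    rw [Finset.mem_erase] at hj
    exact hcop hh hj.2 hj.1.symm
  obtain ⟨a, b, hab⟩ := hcop'
  set k := ∏ j ∈ S.erase h, j
  have hx : aeval φ h (aeval φ a x) + aeval φ k (aeval φ b x) = x := by
    rw [← Module.End.mul_apply, ← Module.End.mul_apply, ← map_mul, ← map_mul,
      ← LinearMap.add_apply, ← map_add, mul_comm h, mul_comm k, hab, map_one, Module.End.one_apply]
  have hk : ψ h (aeval φ k (aeval φ b x)) = 1 := by
    have hev := DFunLike.congr_fun hprod (aeval φ k (aeval φ b x))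
    rw [AddChar.prod_apply, ← Finset.mul_prod_erase S _ hh, Finset.prod_eq_one fun j hj => ?_,
      mul_one] at hev
    · simpa using hev
    · rw [show k = _ from (Finset.mul_prod_erase (S.erase h) (fun j => j) hj).symm, map_mul,
        Module.End.mul_apply]
      exact hψ j (Finset.mem_of_mem_erase hj) _
  rw [← hx, AddChar.map_add_eq_mul, hψ h hh, hk, one_mul, AddChar.one_apply]

end Frobenius

section Factors

variable {F : Type*} [Field F]

theorem pairwise_isCoprime_of_irreducible_of_monic {t : Set F[X]}
    (ht : ∀ h ∈ t, Irreducible h ∧ h.Monic) : t.Pairwise IsCoprime := by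
  intro g hg h hh hne
  refine (ht g hg).1.coprime_iff_not_dvd.mpr fun hdvd => hne ?_
  exact eq_of_monic_of_associated (ht g hg).2 (ht h hh).2
    ((ht g hg).1.associated_of_dvd (ht h hh).1 hdvd)

/-- If `1` is the only `n`-th root of unity of `F`, at most one irreducible factor of `X ^ n - 1` is
linear, so there are at most `(n + 1) / 2` distinct ones. -/
theorem two_mul_card_irreducible_factors_le {n : ℕ} (hn : 0 < n)
    (hroot : ∀ a : F, a ^ n = 1 → a = 1) {t : Finset F[X]}
    (ht : ∀ h ∈ t, Irreducible h ∧ h.Monic ∧ h ∣ X ^ n - 1) : 2 * t.card ≤ n + 1 := by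
  classical
  have hT : (X ^ n - 1 : F[X]) ≠ 0 := (monic_X_pow_sub_C (1 : F) hn.ne').ne_zero
  have hdeg (h) (hh : h ∈ t.erase (X - 1)) : 2 ≤ h.natDegree := by
    rw [Finset.mem_erase] at hh
    obtain ⟨hirr, hmon, hdvd⟩ := ht h hh.2
    by_contra! hlt
    have hpos := hirr.natDegree_pos
    have h1 : h.natDegree = 1 := by omega
    have hX := hmon.eq_X_add_C h1
    have hr := hroot (-h.coeff 0) (by
      have h0 : eval (-h.coeff 0) (X ^ n - 1 : F[X]) = 0 :=
        eval_eq_zero_of_dvd_of_eval_eq_zero hdvd (by rw [hX]; simp)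
      simpa [sub_eq_zero] using h0)
    apply hh.1
    rw [hX, ← neg_neg (h.coeff 0), hr]
    simp [sub_eq_add_neg]
  have hprod : ∏ h ∈ t, h ∣ X ^ n - 1 :=
    Finset.prod_dvd_of_coprime
      (pairwise_isCoprime_of_irreducible_of_monic fun h hh => ⟨(ht h hh).1, (ht h hh).2.1⟩)
      fun h hh => (ht h hh).2.2
  have hsum : ∑ h ∈ t, h.natDegree ≤ n := by
    rw [← natDegree_prod_of_monic t (fun h => h) fun h hh => (ht h hh).2.1]
    exact (natDegree_le_of_dvd hprod hT).trans (natDegree_X_pow_sub_C (r := (1 : F))).le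
  have hlow : 2 * (t.erase (X - 1)).card ≤ ∑ h ∈ t.erase (X - 1), h.natDegree := by
    rw [mul_comm, ← smul_eq_mul]
    exact Finset.card_nsmul_le_sum _ _ _ hdeg
  by_cases h1 : (X - 1 : F[X]) ∈ t
  · rw [← Finset.add_sum_erase _ _ h1] at hsum
    have : (X - 1 : F[X]).natDegree = 1 := natDegree_X_sub_C (1 : F)
    have := Finset.card_erase_add_one h1
    omega
  · rw [Finset.erase_eq_of_notMem h1] at hlow
    omega

end Factors

section Reduction

theorem isFree_of_forall_prime {E : Type*} [Field E] {m : ℕ} {γ : E} (hγ : γ ≠ 0)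
    (h : ∀ l : ℕ, l.Prime → l ∣ m → ∀ β : E, γ ≠ β ^ l) : IsFree m γ := by
  refine ⟨hγ, fun d hd ⟨β, hβ⟩ => ?_⟩
  by_contra hd1
  obtain ⟨l, hl, k, rfl⟩ := Nat.exists_prime_and_dvd hd1
  exact h l hl ((dvd_mul_right l k).trans hd) (β ^ k) (by rw [hβ, ← pow_mul, mul_comm])

theorem isPolyFree_of_forall_irreducible {F E : Type*} [Field F] [Fintype F] [Field E]
    [Algebra F E] {T : F[X]} {a : E}
    (h : ∀ g : F[X], Irreducible g → g.Monic → g ∣ T → ∀ b, aeval (frobLin F E) g b ≠ a) :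
    IsPolyFree (Fintype.card F) T a := by
  intro k hk hkT ⟨b, hb⟩
  by_contra hk1
  obtain ⟨g, hgm, hgi, c, rfl⟩ :=
    exists_monic_irreducible_factor k fun hu => hk1 (hk.eq_one_of_isUnit hu)
  refine h g hgi hgm ((dvd_mul_right g c).trans hkT) (aeval (frobLin F E) c b) ?_
  rw [← hb, Lf_eq_aeval_frobLin, map_mul, Module.End.mul_apply]

end Reduction

/-- Let `p` be a prime, `q` a power of `p`, and `n = p^α·n₀ ≥ 5` with `p ∤ n₀` and
`gcd(q - 1, n₀) = 1`.  Suppose `x^n - 1` has a monic factor `f` of degree 2 in `F_q[x]`.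
If `q^{n/2-2} ≥ 2^{(n+1)/2}·W(q^n - 1)`, then `N_f(x^n-1, q^n-1) > 0`. -/
theorem Nf_pos_case_coprime (p : ℕ) (hp : p.Prime) (q e : ℕ) (he : 0 < e) (hq : q = p ^ e)
    (α n₀ n : ℕ) (hn : n = p ^ α * n₀) (hn5 : 5 ≤ n) (hpn : ¬ p ∣ n₀)
    (hgcd : Nat.gcd (q - 1) n₀ = 1)
    (F E : Type*) [Field F] [Fintype F] [Field E] [Fintype E] [Algebra F E]
    (hF : Fintype.card F = q) (hE : Fintype.card E = q ^ n)
    (f : Polynomial F) (hfm : f.Monic) (hfd : f.natDegree = 2)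
    (hfdvd : f ∣ (X : Polynomial F) ^ n - 1)
    (hbound : (2 : ℝ) ^ (((n : ℝ) + 1) / 2) * (Wnat (q ^ n - 1) : ℝ)
      ≤ (q : ℝ) ^ ((n : ℝ) / 2 - 2)) :
    0 < Nf q F E f ((X : Polynomial F) ^ n - 1) (q ^ n - 1) := by
  classical
  subst hF
  set q := Fintype.card F with hq_def
  have hq1 : 1 < q := Fintype.one_lt_card
  have hn0 : 0 < n := by omega
  have hrank : Module.finrank F E = n := by
    have h := Module.card_eq_pow_finrank (K := F) (V := E)
    rw [hE] at h
    exact (Nat.pow_right_injective hq1 h).symm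
  have hT : (X ^ n - 1 : F[X]) ≠ 0 := (monic_X_pow_sub_C (1 : F) hn0.ne').ne_zero
  have hm0 : q ^ n - 1 ≠ 0 := by
    have := Nat.one_lt_pow hn0.ne' hq1
    omega
  have hroot (a : F) (ha : a ^ n = 1) : a = 1 := by
    have : Fact p.Prime := ⟨hp⟩
    have : CharP F p := by
      obtain ⟨c, hc⟩ := CharP.exists F
      obtain ⟨m, hcp, hcard⟩ := FiniteField.card F c
      have hpc : p ∣ c ^ (m : ℕ) := by
        rw [← hcard, ← hq_def, hq]
        exact dvd_pow_self p he.ne'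
      rwa [(Nat.prime_dvd_prime_iff_eq hp hcp).mp (hp.dvd_of_dvd_pow hpc)]
    have ha0 : a ≠ 0 := by
      rintro rfl
      rw [zero_pow hn0.ne'] at ha
      exact zero_ne_one ha
    have h1 : a ^ n₀ = 1 := by
      rw [hn, mul_comm, pow_mul] at ha
      apply iterateFrobenius_inj F p α
      simpa [iterateFrobenius_def] using ha
    have h2 : a ^ (q - 1) = 1 := FiniteField.pow_card_sub_one_eq_one a ha0
    have h3 : orderOf a ∣ 1 := hgcd ▸ Nat.dvd_gcd (orderOf_dvd_of_pow_eq_one h2)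
      (orderOf_dvd_of_pow_eq_one h1)
    exact orderOf_eq_one_iff.mp (Nat.dvd_one.mp h3)
  let s := (q ^ n - 1).primeFactors
  let t := (UniqueFactorizationMonoid.normalizedFactors (X ^ n - 1 : F[X])).toFinset
  have ht {h : F[X]} : h ∈ t ↔ Irreducible h ∧ h.Monic ∧ h ∣ X ^ n - 1 := by
    rw [Multiset.mem_toFinset, Polynomial.mem_normalizedFactors_iff hT]
  have hχex (l : ℕ) : ∃ χ : MulChar E ℂ, l ∈ s → orderOf χ = l := by
    by_cases hl : l ∈ s
    · obtain ⟨χ, hχ⟩ := MulChar.exists_mulChar_orderOf E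
        (by rw [hE]; exact Nat.dvd_of_mem_primeFactors hl)
        (Complex.isPrimitiveRoot_exp l (Nat.prime_of_mem_primeFactors hl).ne_zero)
      exact ⟨χ, fun _ => hχ⟩
    · exact ⟨1, fun h => absurd h hl⟩
  choose χ hχ using hχex
  have hψex (h : F[X]) : ∃ ψ : AddChar E ℂ,
      h ∈ t → ψ ≠ 1 ∧ ∀ x, ψ (aeval (frobLin F E) h x) = 1 := by
    by_cases hh : h ∈ t
    · have hns := aeval_frobLin_not_surjective (E := E) (ht.mp hh).1
        (by rw [hrank]; exact (ht.mp hh).2.2)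
      have htop : (aeval (frobLin F E) h).toAddMonoidHom.range ≠ ⊤ :=
        fun h' => hns (AddMonoidHom.range_eq_top.mp h')
      obtain ⟨ψ, hψ1, hψ⟩ := AddSubgroup.exists_addChar_ne_one htop
      exact ⟨ψ, fun _ => ⟨hψ1, fun x => hψ _ ⟨x, rfl⟩⟩⟩
    · exact ⟨1, fun h' => absurd h' hh⟩
  choose ψ hψ using hψex
  have hcard : (2 : ℝ) ^ s.card * 2 ^ t.card *
      Nat.card (aeval (frobLin F E) f).toAddMonoidHom.ker ≤ √(Fintype.card E) := by
    have hs : (2 : ℝ) ^ s.card ≤ Wnat (q ^ n - 1) := by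
      exact_mod_cast two_pow_card_primeFactors_le_Wnat hm0
    have htc : (2 : ℝ) ^ t.card ≤ 2 ^ (((n : ℝ) + 1) / 2) := by
      rw [← Real.rpow_natCast]
      refine Real.rpow_le_rpow_of_exponent_le one_le_two ?_
      have : (2 * t.card : ℝ) ≤ n + 1 := by
        exact_mod_cast two_mul_card_irreducible_factors_le hn0 hroot fun h hh => ht.mp hh
      linarith
    have hker : (Nat.card (aeval (frobLin F E) f).toAddMonoidHom.ker : ℝ) ≤ (q : ℝ) ^ 2 := by
      have := card_ker_aeval_frobLin_le (E := E) hfm.ne_zero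
      rw [hfd] at this
      exact_mod_cast this
    have hq0 : (0 : ℝ) < q := by exact_mod_cast hq1.le
    calc (2 : ℝ) ^ s.card * 2 ^ t.card * Nat.card (aeval (frobLin F E) f).toAddMonoidHom.ker
        ≤ Wnat (q ^ n - 1) * 2 ^ (((n : ℝ) + 1) / 2) * (q : ℝ) ^ 2 := by gcongr
      _ ≤ (q : ℝ) ^ ((n : ℝ) / 2 - 2) * (q : ℝ) ^ 2 := by
          rw [mul_comm (Wnat _ : ℝ)]
          gcongr
      _ = √(Fintype.card E) := by
          rw [hE, ← Real.rpow_natCast (q : ℝ) 2, ← Real.rpow_add hq0, Real.sqrt_eq_rpow,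
            Nat.cast_pow, ← Real.rpow_natCast, ← Real.rpow_mul hq0.le]
          congr 1
          push_cast
          ring
  obtain ⟨a, hLa, hmul, hadd⟩ := exists_forall_char_ne_one
    (aeval (frobLin F E) f).toAddMonoidHom s χ
    (fun S hS hne => prod_ne_one_of_orderOf_prime
      (fun l hl => Nat.prime_of_mem_primeFactors (hS hl)) (fun l hl => hχ l (hS hl)) hne)
    t ψ
    (fun S hS hne => prod_addChar_ne_one_of_coprime (frobLin F E)
      (pairwise_isCoprime_of_irreducible_of_monic fun h hh =>
        ⟨(ht.mp (hS hh)).1, (ht.mp (hS hh)).2.1⟩)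
      (fun h hh => (hψ h (hS hh)).1) (fun h hh => (hψ h (hS hh)).2) hne)
    hcard
  rw [LinearMap.toAddMonoidHom_coe, ← Lf_eq_aeval_frobLin] at hLa hmul
  refine Nat.card_pos_iff.mpr ⟨⟨a, ?_, ?_⟩, inferInstance⟩
  · refine isPolyFree_of_forall_irreducible fun g hgi hgm hgd b hb => ?_
    have hg := ht.mpr ⟨hgi, hgm, hgd⟩
    exact hadd g hg (hb ▸ (hψ g hg).2 b)
  · refine isFree_of_forall_prime hLa fun l hl hlm β hβ => ?_
    have hls : l ∈ s := Nat.mem_primeFactors.mpr ⟨hl, hlm, hm0⟩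
    refine hmul l hls ?_
    have hβ0 : β ≠ 0 := by
      rintro rfl
      exact hLa (by rw [hβ, zero_pow hl.ne_zero])
    have hpow : χ l ^ l = 1 := orderOf_dvd_iff_pow_eq_one.mp (hχ l hls).dvd
    rw [hβ, map_pow, ← MulChar.pow_apply' _ hl.ne_zero, hpow,
      MulChar.one_apply (isUnit_iff_ne_zero.mpr hβ0)]

end
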